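/- Let r₁ = p₁/q₁ and r₂ = p₂/q₂ be distinct rational numbers in lowest terms with p₁ and p₂ nonzero. For i = 1, 2: if two points (θ,η) and (θ',η') of S(r₁) ∩ S(r₂) ∩ W* are adjacent in S(r_i), then |η − η'| = d_i(r₁,r₂). -/

import Mathlib

open Real

/-- The set `S(p/q) = {(θ,η) : pθ+qη ∈ 2πℤ or pθ+pπ+qη ∈ 2πℤ}`. -/
def Spq (p q : ℤ) : Set (ℝ × ℝ) :=
  {x | (∃ k : ℤ, (p : ℝ) * x.1 + (q : ℝ) * x.2 = 2 * π * k) ∨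
       (∃ k : ℤ, (p : ℝ) * x.1 + (p : ℝ) * π + (q : ℝ) * x.2 = 2 * π * k)}

/-- The set `Ŝ(p/q) = {(θ,η) : pθ+qη ∈ πℤ}`. -/
def Shat (p q : ℤ) : Set (ℝ × ℝ) :=
  {x | ∃ k : ℤ, (p : ℝ) * x.1 + (q : ℝ) * x.2 = π * k}

/-- The open strip `W* = ℝ × (0, 2π)`. -/
def Wstar : Set (ℝ × ℝ) :=
  {x | 0 < x.2 ∧ x.2 < 2 * π}

/-- Two points `a ≠ b` are adjacent in `L` relative to the set `X` of intersection points: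
they lie on the same connected component of `L` and no point of `X` lies strictly
between them. -/
def AdjacentIn (L X : Set (ℝ × ℝ)) (a b : ℝ × ℝ) : Prop :=
  a ≠ b ∧ b ∈ connectedComponentIn L a ∧ ∀ c ∈ X, c ∉ openSegment ℝ a b

/-- The quantity `d₁(r₁,r₂)` of the paper, where `r₁ = p₁/q₁` and `r₂ = p₂/q₂`:
`2π|p₁|/Δ(r₁,r₂)` if `p₂` is even, and `π|p₁|/Δ(r₁,r₂)` if `p₂` is odd
(`d₂(r₁,r₂)` is obtained by swapping the roles of the two fractions). -/
noncomputable def dd (p₁ q₁ p₂ q₂ : ℤ) : ℝ :=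
  if Even p₂ then 2 * π * |(p₁ : ℝ)| / |((p₁ * q₂ - p₂ * q₁ : ℤ) : ℝ)|
  else π * |(p₁ : ℝ)| / |((p₁ * q₂ - p₂ * q₁ : ℤ) : ℝ)|

/-- The spacing, in units of `π`, of the values of `pθ + qη` on `Spq p q`. -/
noncomputable def levelGap (p : ℤ) : ℝ := if Even p then 2 else 1

theorem mem_Spq_iff (p q : ℤ) (x : ℝ × ℝ) :
    x ∈ Spq p q ↔ ∃ k : ℤ, (p : ℝ) * x.1 + (q : ℝ) * x.2 = levelGap p * π * k := by
  unfold levelGap Spq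
  simp only [Set.mem_ofPred_eq]
  rcases Int.even_or_odd p with h | h
  · rw [if_pos h]
    obtain ⟨n, rfl⟩ := h
    constructor
    · rintro (⟨k, hk⟩ | ⟨k, hk⟩)
      · exact ⟨k, hk⟩
      · refine ⟨k - n, ?_⟩
        push_cast at hk ⊢
        linear_combination hk
    · exact Or.inl
  · rw [if_neg (Int.not_even_iff_odd.mpr h)]
    obtain ⟨n, rfl⟩ := h
    constructor
    · rintro (⟨k, hk⟩ | ⟨k, hk⟩)
      · refine ⟨2 * k, ?_⟩
        push_cast at hk ⊢
        linear_combination hk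
      · refine ⟨2 * k - (2 * n + 1), ?_⟩
        push_cast at hk ⊢
        linear_combination hk
    · rintro ⟨k, hk⟩
      rcases Int.even_or_odd' k with ⟨j, rfl | rfl⟩
      · refine Or.inl ⟨j, ?_⟩
        push_cast at hk ⊢
        linear_combination hk
      · refine Or.inr ⟨j + n + 1, ?_⟩
        push_cast at hk ⊢
        linear_combination hk

theorem levelGap_pos (p : ℤ) : 0 < levelGap p := by
  unfold levelGap
  split_ifs <;> norm_num

theorem dd_eq (p₁ q₁ p₂ q₂ : ℤ) :
    dd p₁ q₁ p₂ q₂ =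
      levelGap p₂ * π * |(p₁ : ℝ)| / |((p₁ * q₂ - p₂ * q₁ : ℤ) : ℝ)| := by
  unfold dd levelGap
  split_ifs <;> ring

/-- Points in one connected component of a subset of `Spq p q` lie on a common line. -/
theorem level_eq_of_mem_connectedComponentIn {p q : ℤ} {L : Set (ℝ × ℝ)} (hL : L ⊆ Spq p q)
    {a b : ℝ × ℝ} (h : b ∈ connectedComponentIn L a) :
    (p : ℝ) * a.1 + (q : ℝ) * a.2 = (p : ℝ) * b.1 + (q : ℝ) * b.2 := by
  have ha : a ∈ L := by
    by_contra ha
    rw [connectedComponentIn_eq_empty ha] at h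
    exact h
  let f : ℝ × ℝ → ℝ := fun x => (p : ℝ) * x.1 + (q : ℝ) * x.2
  have hf : Continuous f := by fun_prop
  have hpre : IsPreconnected (f '' connectedComponentIn L a) :=
    isPreconnected_connectedComponentIn.image f hf.continuousOn
  have hcount : (f '' connectedComponentIn L a).Countable := by
    refine (Set.countable_range fun k : ℤ => levelGap p * π * k).mono ?_
    rintro _ ⟨x, hx, rfl⟩
    obtain ⟨k, hk⟩ := (mem_Spq_iff p q x).1 (hL (connectedComponentIn_subset L a hx))
    exact ⟨k, hk.symm⟩
  exact hcount.isTotallyDisconnected _ subset_rfl hpre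
    ⟨a, mem_connectedComponentIn ha, rfl⟩ ⟨b, h, rfl⟩

theorem convex_Wstar : Convex ℝ Wstar := by
  have h : Wstar = Prod.snd ⁻¹' Set.Ioo (0 : ℝ) (2 * π) := rfl
  rw [h]
  exact (convex_Ioo _ _).linear_preimage (LinearMap.snd ℝ ℝ ℝ)

theorem abs_sub_eq_dd_of_adjacentIn {p₁ q₁ p₂ q₂ : ℤ} (hne : p₁ * q₂ ≠ p₂ * q₁)
    {a b : ℝ × ℝ} (ha : a ∈ Spq p₁ q₁ ∩ Spq p₂ q₂ ∩ Wstar)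
    (hb : b ∈ Spq p₁ q₁ ∩ Spq p₂ q₂ ∩ Wstar)
    (hab : AdjacentIn (Spq p₁ q₁ ∩ Wstar) (Spq p₁ q₁ ∩ Spq p₂ q₂ ∩ Wstar) a b) :
    |a.2 - b.2| = dd p₁ q₁ p₂ q₂ := by
  obtain ⟨hne_ab, hconn, hbetween⟩ := hab
  have hline := level_eq_of_mem_connectedComponentIn Set.inter_subset_left hconn
  obtain ⟨i, hi⟩ := (mem_Spq_iff _ _ _).1 ha.1.1
  obtain ⟨m, hm⟩ := (mem_Spq_iff _ _ _).1 ha.1.2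
  obtain ⟨n, hn⟩ := (mem_Spq_iff _ _ _).1 hb.1.2
  have hdet : ((p₁ * q₂ - p₂ * q₁ : ℤ) : ℝ) ≠ 0 := by
    exact_mod_cast sub_ne_zero.2 hne
  have hsnd : ((p₁ * q₂ - p₂ * q₁ : ℤ) : ℝ) * (a.2 - b.2) =
      levelGap p₂ * π * p₁ * ((m - n : ℤ) : ℝ) := by
    push_cast
    linear_combination (p₁ : ℝ) * (hm - hn) - (p₂ : ℝ) * hline
  have hfst : ((p₁ * q₂ - p₂ * q₁ : ℤ) : ℝ) * (a.1 - b.1) =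
      -(levelGap p₂ * π * q₁ * ((m - n : ℤ) : ℝ)) := by
    push_cast
    linear_combination (q₂ : ℝ) * hline - (q₁ : ℝ) * (hm - hn)
  have hk0 : m - n ≠ 0 := by
    intro h0
    rw [h0] at hsnd hfst
    simp only [Int.cast_zero, mul_zero, neg_zero, mul_eq_zero, hdet, false_or, sub_eq_zero]
      at hsnd hfst
    exact hne_ab (Prod.ext hfst hsnd)
  have hk1 : |m - n| = 1 := by
    by_contra h1
    have h2 : 1 < |m - n| := lt_of_le_of_ne (Int.one_le_abs hk0) (Ne.symm h1)
    have h2' : (1 : ℝ) < |((m - n : ℤ) : ℝ)| := by exact_mod_cast h2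
    set t : ℝ := |((m - n : ℤ) : ℝ)|⁻¹ with ht
    have ht0 : 0 < t := inv_pos.2 (by linarith)
    have ht1 : t < 1 := inv_lt_one_of_one_lt₀ h2'
    have hsign : t * ((m - n : ℤ) : ℝ) = ((m - n).sign : ℝ) := by
      have h3 : ((m - n : ℤ) : ℝ) = ((m - n).sign : ℝ) * |((m - n : ℤ) : ℝ)| := by
        exact_mod_cast (Int.sign_mul_abs (m - n)).symm
      rw [ht]
      nth_rewrite 2 [h3]
      field_simp
    have hc : (1 - t) • a + t • b ∈ openSegment ℝ a b :=
      ⟨1 - t, t, by linarith, ht0, by ring, rfl⟩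
    refine hbetween _ ⟨⟨(mem_Spq_iff _ _ _).2 ⟨i, ?_⟩, (mem_Spq_iff _ _ _).2
      ⟨m - (m - n).sign, ?_⟩⟩, convex_Wstar.openSegment_subset ha.2 hb.2 hc⟩ hc
    · simp only [Prod.fst_add, Prod.snd_add, Prod.smul_fst, Prod.smul_snd, smul_eq_mul]
      linear_combination hi - t * hline
    · simp only [Prod.fst_add, Prod.snd_add, Prod.smul_fst, Prod.smul_snd, smul_eq_mul]
      rw [Int.cast_sub, ← hsign]
      push_cast
      linear_combination (1 - t) * hm + t * hn
  rw [dd_eq, eq_div_iff (abs_ne_zero.2 hdet), mul_comm, ← abs_mul, hsnd, abs_mul, abs_mul,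
    ← Int.cast_abs (a := m - n), hk1, abs_of_pos (mul_pos (levelGap_pos p₂) pi_pos)]
  simp

/-- If two points of `S(r₁) ∩ S(r₂) ∩ W*` are adjacent in `S(rᵢ)`, then their heights
differ by exactly `dᵢ(r₁,r₂)`. -/
theorem statement_6 (p₁ q₁ p₂ q₂ : ℤ) (hq₁ : q₁ ≠ 0) (hq₂ : q₂ ≠ 0)
    (hp₁ : p₁ ≠ 0) (hp₂ : p₂ ≠ 0)
    (hc₁ : IsCoprime p₁ q₁) (hc₂ : IsCoprime p₂ q₂)
    (hne : p₁ * q₂ ≠ p₂ * q₁) :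
    (∀ a b : ℝ × ℝ, a ∈ Spq p₁ q₁ ∩ Spq p₂ q₂ ∩ Wstar → b ∈ Spq p₁ q₁ ∩ Spq p₂ q₂ ∩ Wstar →
      AdjacentIn (Spq p₁ q₁ ∩ Wstar) (Spq p₁ q₁ ∩ Spq p₂ q₂ ∩ Wstar) a b →
      |a.2 - b.2| = dd p₁ q₁ p₂ q₂) ∧
    (∀ a b : ℝ × ℝ, a ∈ Spq p₁ q₁ ∩ Spq p₂ q₂ ∩ Wstar → b ∈ Spq p₁ q₁ ∩ Spq p₂ q₂ ∩ Wstar →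
      AdjacentIn (Spq p₂ q₂ ∩ Wstar) (Spq p₁ q₁ ∩ Spq p₂ q₂ ∩ Wstar) a b →
      |a.2 - b.2| = dd p₂ q₂ p₁ q₁) := by
  refine ⟨fun a b ha hb hab => abs_sub_eq_dd_of_adjacentIn hne ha hb hab, fun a b ha hb hab => ?_⟩
  rw [Set.inter_comm (Spq p₁ q₁)] at ha hb hab
  exact abs_sub_eq_dd_of_adjacentIn hne.symm ha hb hab
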